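/- (Theorem 3, noiseless form) Let m ≥ 1 and H ≥ 1 be integers. Let (M_k)_{k≥0} be linear maps on ℝ^S with sup_k ‖M_k‖_∞ ≤ δ'_FV, let V_0 ∈ ℝ^S, let (γ_k) satisfy γ_k ∈ (0,1] and Σ_k γ_k = ∞, and define V_{k+1} = (1−γ_k)V_k + γ_k·M_k(T_{μ_{k+1},ν_{k+1}}^m(T^{H−1}V_k)), where for each k the pair (μ_{k+1},ν_{k+1}) is an H-step lookahead policy for V_k. Let δ'_app ≥ 0 satisfy ‖M_k J^{μ_{k+1},ν_{k+1}} − J^{μ_{k+1},ν_{k+1}}‖_∞ ≤ δ'_app for all k, and suppose δ'_FV·α^{m+H−1}·(1+α)/(1−α) + 2α^{H−1}/(1−α) < 1. Then limsup_{k→∞} ‖V_k − J*‖_∞ ≤ δ'_app / (1 − (α^{H−1} + (1+α)·(1 + α^m·δ'_FV)·α^{H−1}/(1−α))). -/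

import Mathlib

open Finset Filter Topology Matrix

noncomputable section

/-- The probability simplex over a finite subset `D` of actions: nonnegative
weights summing to one over `D` and vanishing outside `D`. -/
def simplex {A : Type*} [Fintype A] (D : Finset A) : Set (A → ℝ) :=
  {p | (∀ a, 0 ≤ p a) ∧ (∑ a ∈ D, p a = 1) ∧ ∀ a ∉ D, p a = 0}

/-- A finite two-player zero-sum discounted Markov game. `S` is the state space,
`A` the maximizer's global action type, `B` the minimizer's global action type. -/
structure MarkovGame (S A B : Type*) [Fintype S] [Fintype A] [Fintype B] where
  U : S → Finset A
  W : S → Finset B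
  U_nonempty : ∀ s, (U s).Nonempty
  W_nonempty : ∀ s, (W s).Nonempty
  P : S → A → B → S → ℝ
  P_nonneg : ∀ s u v s', 0 ≤ P s u v s'
  P_sum : ∀ s, ∀ u ∈ U s, ∀ v ∈ W s, ∑ s', P s u v s' = 1
  g : S → A → B → ℝ
  g_nonneg : ∀ s u v, 0 ≤ g s u v
  g_le_one : ∀ s u v, g s u v ≤ 1
  α : ℝ
  α_pos : 0 < α
  α_lt_one : α < 1

namespace MarkovGame

variable {S A B : Type*} [Fintype S] [Fintype A] [Fintype B]

/-- The state-action value matrix `A_{V,s}(u,v) = g(s,u,v) + α Σ_{s'} P(s'|s,u,v) V(s')`. -/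
def Aval (G : MarkovGame S A B) (V : S → ℝ) (s : S) (u : A) (v : B) : ℝ :=
  G.g s u v + G.α * ∑ s', G.P s u v s' * V s'

/-- A policy pair assigns to each state probability vectors over the available actions. -/
def IsPolicy (G : MarkovGame S A B) (μ : S → A → ℝ) (ν : S → B → ℝ) : Prop :=
  ∀ s, μ s ∈ simplex (G.U s) ∧ ν s ∈ simplex (G.W s)

/-- The Bellman operator of a policy pair: `(T_{μ,ν}V)(s) = μ(s)ᵀ A_{V,s} ν(s)`. -/
def Tpol (G : MarkovGame S A B) (μ : S → A → ℝ) (ν : S → B → ℝ) (V : S → ℝ) : S → ℝ :=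
  fun s => ∑ u ∈ G.U s, ∑ v ∈ G.W s, μ s u * ν s v * G.Aval V s u v

/-- The Bellman optimality operator:
`(TV)(s) = max_{p ∈ Δ(U(s))} min_{q ∈ Δ(V(s))} pᵀ A_{V,s} q`. -/
def T (G : MarkovGame S A B) (V : S → ℝ) : S → ℝ :=
  fun s => sSup {x | ∃ p ∈ simplex (G.U s),
    x = sInf {y | ∃ q ∈ simplex (G.W s),
      y = ∑ u ∈ G.U s, ∑ v ∈ G.W s, p u * q v * G.Aval V s u v}}

/-- The transition matrix `P_{μ,ν}` of a policy pair. -/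
def Ppol (G : MarkovGame S A B) (μ : S → A → ℝ) (ν : S → B → ℝ) : Matrix S S ℝ :=
  Matrix.of fun s s' => ∑ u ∈ G.U s, ∑ v ∈ G.W s, μ s u * ν s v * G.P s u v s'

/-- The expected one-step reward `g_{μ,ν}` of a policy pair. -/
def gpol (G : MarkovGame S A B) (μ : S → A → ℝ) (ν : S → B → ℝ) : S → ℝ :=
  fun s => ∑ u ∈ G.U s, ∑ v ∈ G.W s, μ s u * ν s v * G.g s u v

/-- `(μ,ν)` is an `H`-step lookahead policy for `V` if it is a policy pair and
`T_{μ,ν}(T^{H-1}V) = T^H V`. -/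
def IsLookahead (G : MarkovGame S A B) (H : ℕ) (μ : S → A → ℝ) (ν : S → B → ℝ)
    (V : S → ℝ) : Prop :=
  G.IsPolicy μ ν ∧ G.Tpol μ ν (G.T^[H - 1] V) = G.T^[H] V

end MarkovGame

section SimplexAverages

variable {A B : Type*} [Fintype A] [Fintype B]

lemma simplex_nonempty {D : Finset A} (hD : D.Nonempty) : (simplex D).Nonempty := by
  classical
  obtain ⟨a, ha⟩ := hD
  refine ⟨Pi.single a 1, fun b => ?_, ?_, fun b hb => ?_⟩
  · by_cases h : b = a
    · subst h; simp
    · simp [h]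
  · simp [ha]
  · have : b ≠ a := fun h => hb (h ▸ ha)
    simp [this]

lemma abs_sum_sum_simplex_le {D : Finset A} {E : Finset B} {p : A → ℝ} {q : B → ℝ}
    (hp : p ∈ simplex D) (hq : q ∈ simplex E) {F : A → B → ℝ} {c : ℝ}
    (hF : ∀ u ∈ D, ∀ v ∈ E, |F u v| ≤ c) :
    |∑ u ∈ D, ∑ v ∈ E, p u * q v * F u v| ≤ c := by
  calc |∑ u ∈ D, ∑ v ∈ E, p u * q v * F u v|
      ≤ ∑ u ∈ D, ∑ v ∈ E, |p u * q v * F u v| :=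
        (Finset.abs_sum_le_sum_abs _ _).trans
          (Finset.sum_le_sum fun u _ => Finset.abs_sum_le_sum_abs _ _)
    _ ≤ ∑ u ∈ D, ∑ v ∈ E, p u * q v * c := by
        refine Finset.sum_le_sum fun u hu => Finset.sum_le_sum fun v hv => ?_
        have hpq : 0 ≤ p u * q v := mul_nonneg (hp.1 u) (hq.1 v)
        rw [abs_mul, abs_of_nonneg hpq]
        exact mul_le_mul_of_nonneg_left (hF u hu v hv) hpq
    _ = c := by
        simp_rw [← Finset.sum_mul, ← Finset.mul_sum, hq.2.1, mul_one, hp.2.1, one_mul]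

end SimplexAverages

/-- Saddle values on nonempty sets perturb by at most the uniform perturbation of a bounded
payoff. -/
lemma sSup_sInf_le_add {X Y : Type*} {C : Set X} {D : Set Y} (hC : C.Nonempty) (hD : D.Nonempty)
    {f g : X → Y → ℝ} {b c : ℝ} (hf : ∀ p ∈ C, ∀ q ∈ D, |f p q| ≤ b)
    (hg : ∀ p ∈ C, ∀ q ∈ D, |g p q| ≤ b) (hfg : ∀ p ∈ C, ∀ q ∈ D, f p q ≤ g p q + c) :
    sSup {x | ∃ p ∈ C, x = sInf {y | ∃ q ∈ D, y = f p q}} ≤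
      sSup {x | ∃ p ∈ C, x = sInf {y | ∃ q ∈ D, y = g p q}} + c := by
  have hbelow : ∀ {f : X → Y → ℝ}, (∀ p ∈ C, ∀ q ∈ D, |f p q| ≤ b) → ∀ p ∈ C,
      BddBelow {y | ∃ q ∈ D, y = f p q} := by
    rintro f hf p hp
    refine ⟨-b, ?_⟩
    rintro _ ⟨q, hq, rfl⟩
    exact (abs_le.mp (hf p hp q hq)).1
  obtain ⟨p₀, hp₀⟩ := hC
  obtain ⟨q₀, hq₀⟩ := hD
  have habove : BddAbove {x | ∃ p ∈ C, x = sInf {y | ∃ q ∈ D, y = g p q}} := by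
    refine ⟨b, ?_⟩
    rintro _ ⟨p, hp, rfl⟩
    exact (csInf_le (hbelow hg p hp) ⟨q₀, hq₀, rfl⟩).trans (abs_le.mp (hg p hp q₀ hq₀)).2
  refine csSup_le ⟨_, p₀, hp₀, rfl⟩ ?_
  rintro _ ⟨p, hp, rfl⟩
  have h₁ : sInf {y | ∃ q ∈ D, y = f p q} - c ≤ sInf {y | ∃ q ∈ D, y = g p q} := by
    refine le_csInf ⟨_, q₀, hq₀, rfl⟩ ?_
    rintro _ ⟨q, hq, rfl⟩
    have := csInf_le (hbelow hf p hp) ⟨q, hq, rfl⟩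
    linarith [hfg p hp q hq]
  have h₂ := le_csSup habove ⟨p, hp, rfl⟩
  linarith

/-- A real sequence satisfying an averaged affine contraction, with step sizes that are not
summable, has upper limit at most the fixed point `δ / c` of the affine map. -/
lemma limsup_le_of_averaged_contraction {e γ : ℕ → ℝ} {c δ : ℝ} (he : ∀ k, 0 ≤ e k)
    (hc : 0 < c) (hγc : ∀ k, γ k * c ≤ 1)
    (hγ : Tendsto (fun n => ∑ k ∈ Finset.range n, γ k) atTop atTop)
    (hstep : ∀ k, e (k + 1) ≤ (1 - γ k * c) * e k + γ k * δ) :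
    limsup e atTop ≤ δ / c := by
  have hbound : ∀ k, e k ≤ δ / c +
      Real.exp (-(c * ∑ i ∈ Finset.range k, γ i)) * |e 0 - δ / c| := by
    intro k
    induction k with
    | zero => simpa using by linarith [le_abs_self (e 0 - δ / c)]
    | succ k ih =>
      have hfix : γ k * c * (δ / c) = γ k * δ := by field_simp
      have h₀ : 0 ≤ 1 - γ k * c := sub_nonneg.2 (hγc k)
      have hexp : 1 - γ k * c ≤ Real.exp (-(γ k * c)) := by
        linarith [Real.add_one_le_exp (-(γ k * c))]
      have hprod : (1 - γ k * c) *
          (Real.exp (-(c * ∑ i ∈ Finset.range k, γ i)) * |e 0 - δ / c|) ≤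
          Real.exp (-(γ k * c)) *
            (Real.exp (-(c * ∑ i ∈ Finset.range k, γ i)) * |e 0 - δ / c|) :=
        mul_le_mul_of_nonneg_right hexp (by positivity)
      have hsum : Real.exp (-(c * ∑ i ∈ Finset.range (k + 1), γ i)) =
          Real.exp (-(γ k * c)) * Real.exp (-(c * ∑ i ∈ Finset.range k, γ i)) := by
        rw [← Real.exp_add, Finset.sum_range_succ]
        ring_nf
      rw [hsum, mul_assoc]
      linarith [hstep k, mul_le_mul_of_nonneg_left ih h₀]
  have hlim : Tendsto (fun k => δ / c +
      Real.exp (-(c * ∑ i ∈ Finset.range k, γ i)) * |e 0 - δ / c|) atTop (𝓝 (δ / c)) := by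
    have h := Real.tendsto_exp_neg_atTop_nhds_zero.comp (hγ.const_mul_atTop hc)
    simpa [Function.comp_def] using (h.mul_const |e 0 - δ / c|).const_add (δ / c)
  rw [← hlim.limsup_eq]
  exact limsup_le_limsup (Eventually.of_forall hbound)
    (isCoboundedUnder_le_of_le atTop he) hlim.isBoundedUnder_le

namespace MarkovGame

variable {S A B : Type*} [Fintype S] [Fintype A] [Fintype B]

lemma abs_Aval_sub_le (G : MarkovGame S A B) (V V' : S → ℝ) {s : S} {u : A} {v : B}
    (hu : u ∈ G.U s) (hv : v ∈ G.W s) :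
    |G.Aval V s u v - G.Aval V' s u v| ≤ G.α * ‖V - V'‖ := by
  have h : G.Aval V s u v - G.Aval V' s u v =
      G.α * ∑ s', G.P s u v s' * (V s' - V' s') := by
    simp only [Aval, mul_sub, Finset.sum_sub_distrib]
    ring
  rw [h, abs_mul, abs_of_pos G.α_pos]
  refine mul_le_mul_of_nonneg_left ?_ G.α_pos.le
  calc |∑ s', G.P s u v s' * (V s' - V' s')|
      ≤ ∑ s', |G.P s u v s' * (V s' - V' s')| := Finset.abs_sum_le_sum_abs _ _
    _ ≤ ∑ s', G.P s u v s' * ‖V - V'‖ := by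
        refine Finset.sum_le_sum fun s' _ => ?_
        rw [abs_mul, abs_of_nonneg (G.P_nonneg s u v s')]
        exact mul_le_mul_of_nonneg_left (norm_le_pi_norm (V - V') s') (G.P_nonneg s u v s')
    _ = ‖V - V'‖ := by rw [← Finset.sum_mul, G.P_sum s u hu v hv, one_mul]

lemma abs_Aval_le (G : MarkovGame S A B) (V : S → ℝ) {s : S} {u : A} {v : B}
    (hu : u ∈ G.U s) (hv : v ∈ G.W s) : |G.Aval V s u v| ≤ 1 + G.α * ‖V‖ := by
  have h₀ : |G.Aval 0 s u v| ≤ 1 := by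
    simpa [Aval, abs_of_nonneg (G.g_nonneg s u v)] using G.g_le_one s u v
  have h := G.abs_Aval_sub_le V 0 hu hv
  rw [sub_zero] at h
  linarith [abs_sub_abs_le_abs_sub (G.Aval V s u v) (G.Aval 0 s u v)]

lemma abs_payoff_sub_le (G : MarkovGame S A B) {s : S} {p : A → ℝ} {q : B → ℝ}
    (hp : p ∈ simplex (G.U s)) (hq : q ∈ simplex (G.W s)) (V V' : S → ℝ) :
    |∑ u ∈ G.U s, ∑ v ∈ G.W s, p u * q v * G.Aval V s u v -
      ∑ u ∈ G.U s, ∑ v ∈ G.W s, p u * q v * G.Aval V' s u v| ≤ G.α * ‖V - V'‖ := by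
  simp_rw [← Finset.sum_sub_distrib, ← mul_sub]
  exact abs_sum_sum_simplex_le hp hq fun u hu v hv => G.abs_Aval_sub_le V V' hu hv

lemma norm_Tpol_sub_le (G : MarkovGame S A B) {μ : S → A → ℝ} {ν : S → B → ℝ}
    (h : G.IsPolicy μ ν) (V V' : S → ℝ) :
    ‖G.Tpol μ ν V - G.Tpol μ ν V'‖ ≤ G.α * ‖V - V'‖ :=
  (pi_norm_le_iff_of_nonneg (mul_nonneg G.α_pos.le (norm_nonneg _))).2 fun s =>
    G.abs_payoff_sub_le (h s).1 (h s).2 V V'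

lemma T_apply_le_add (G : MarkovGame S A B) (V V' : S → ℝ) (s : S) :
    G.T V s ≤ G.T V' s + G.α * ‖V - V'‖ := by
  refine sSup_sInf_le_add (b := max (1 + G.α * ‖V‖) (1 + G.α * ‖V'‖))
    (simplex_nonempty (G.U_nonempty s)) (simplex_nonempty (G.W_nonempty s))
    (fun p hp q hq => ?_) (fun p hp q hq => ?_) (fun p hp q hq => ?_)
  · exact abs_sum_sum_simplex_le hp hq fun u hu v hv =>
      (G.abs_Aval_le V hu hv).trans (le_max_left _ _)
  · exact abs_sum_sum_simplex_le hp hq fun u hu v hv =>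
      (G.abs_Aval_le V' hu hv).trans (le_max_right _ _)
  · linarith [(abs_le.mp (G.abs_payoff_sub_le hp hq V V')).2]

lemma norm_T_sub_le (G : MarkovGame S A B) (V V' : S → ℝ) :
    ‖G.T V - G.T V'‖ ≤ G.α * ‖V - V'‖ := by
  refine (pi_norm_le_iff_of_nonneg (mul_nonneg G.α_pos.le (norm_nonneg _))).2 fun s => ?_
  have h₁ := G.T_apply_le_add V V' s
  have h₂ := G.T_apply_le_add V' V s
  rw [norm_sub_rev] at h₂
  rw [Real.norm_eq_abs, Pi.sub_apply, abs_le]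
  constructor <;> linarith

end MarkovGame

section FixedPoints

variable {E : Type*} [SeminormedAddCommGroup E] {f : E → E} {a : ℝ}

lemma norm_iterate_sub_fixedPoint_le (ha : 0 ≤ a) (hf : ∀ x y, ‖f x - f y‖ ≤ a * ‖x - y‖)
    {z : E} (hz : f z = z) (n : ℕ) (x : E) : ‖f^[n] x - z‖ ≤ a ^ n * ‖x - z‖ := by
  induction n with
  | zero => simp
  | succ n ih =>
    rw [Function.iterate_succ_apply', pow_succ', mul_assoc]
    calc ‖f (f^[n] x) - z‖ = ‖f (f^[n] x) - f z‖ := by rw [hz]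
      _ ≤ a * ‖f^[n] x - z‖ := hf _ _
      _ ≤ a * (a ^ n * ‖x - z‖) := mul_le_mul_of_nonneg_left ih ha

lemma norm_sub_fixedPoint_le_div (ha : a < 1) (hf : ∀ x y, ‖f x - f y‖ ≤ a * ‖x - y‖)
    {z : E} (hz : f z = z) (x : E) : ‖x - z‖ ≤ ‖x - f x‖ / (1 - a) := by
  rw [le_div_iff₀ (sub_pos.2 ha)]
  have h₁ := hf x z
  rw [hz] at h₁
  linarith [norm_sub_le_norm_sub_add_norm_sub x (f x) z]

end FixedPoints

namespace MarkovGame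

variable {S A B : Type*} [Fintype S] [Fintype A] [Fintype B]

/-- Distance from the lookahead value to the value of the corresponding lookahead policy. -/
lemma norm_lookahead_sub_Jpol_le (G : MarkovGame S A B) {H : ℕ} (hH : 1 ≤ H)
    {μ : S → A → ℝ} {ν : S → B → ℝ} {V J Jstar : S → ℝ} (hLA : G.IsLookahead H μ ν V)
    (hJ : G.Tpol μ ν J = J) (hJstar : G.T Jstar = Jstar) :
    ‖G.T^[H - 1] V - J‖ ≤ (1 + G.α) * (G.α ^ (H - 1) * ‖V - Jstar‖) / (1 - G.α) := by
  have hα : 0 < 1 - G.α := sub_pos.2 G.α_lt_one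
  refine (norm_sub_fixedPoint_le_div G.α_lt_one (G.norm_Tpol_sub_le hLA.1) hJ _).trans ?_
  have hT : G.Tpol μ ν (G.T^[H - 1] V) = G.T (G.T^[H - 1] V) := by
    rw [hLA.2, ← Function.iterate_succ_apply' G.T, Nat.succ_eq_add_one, Nat.sub_add_cancel hH]
  have hW := norm_iterate_sub_fixedPoint_le G.α_pos.le G.norm_T_sub_le hJstar (H - 1) V
  rw [hT]
  refine div_le_div_of_nonneg_right ?_ hα.le
  have h₁ := G.norm_T_sub_le (G.T^[H - 1] V) Jstar
  rw [hJstar] at h₁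
  have h₂ := norm_sub_le_norm_sub_add_norm_sub (G.T^[H - 1] V) Jstar (G.T (G.T^[H - 1] V))
  rw [norm_sub_rev Jstar] at h₂
  nlinarith [mul_le_mul_of_nonneg_left hW G.α_pos.le]

/-- A full step of approximate lookahead policy evaluation contracts towards the optimal
value, up to the approximation error. -/
lemma norm_update_sub_le (G : MarkovGame S A B) (m : ℕ) {H : ℕ} (hH : 1 ≤ H)
    {M : (S → ℝ) →L[ℝ] (S → ℝ)} {δFV δapp : ℝ} (hM : ‖M‖ ≤ δFV)
    {μ : S → A → ℝ} {ν : S → B → ℝ} {V J Jstar : S → ℝ} (hLA : G.IsLookahead H μ ν V)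
    (hJ : G.Tpol μ ν J = J) (happ : ‖M J - J‖ ≤ δapp) (hJstar : G.T Jstar = Jstar) :
    ‖M ((G.Tpol μ ν)^[m] (G.T^[H - 1] V)) - Jstar‖ ≤
      (G.α ^ (H - 1) + (1 + G.α) * (1 + G.α ^ m * δFV) * G.α ^ (H - 1) / (1 - G.α)) *
        ‖V - Jstar‖ + δapp := by
  set W := G.T^[H - 1] V
  have hδ : 0 ≤ δFV := (norm_nonneg M).trans hM
  have hαm : 0 ≤ G.α ^ m := pow_nonneg G.α_pos.le m
  have hW : ‖W - Jstar‖ ≤ G.α ^ (H - 1) * ‖V - Jstar‖ :=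
    norm_iterate_sub_fixedPoint_le G.α_pos.le G.norm_T_sub_le hJstar (H - 1) V
  have hWJ : ‖W - J‖ ≤ (1 + G.α) * (G.α ^ (H - 1) * ‖V - Jstar‖) / (1 - G.α) :=
    G.norm_lookahead_sub_Jpol_le hH hLA hJ hJstar
  have hiter : ‖(G.Tpol μ ν)^[m] W - J‖ ≤ G.α ^ m * ‖W - J‖ :=
    norm_iterate_sub_fixedPoint_le G.α_pos.le (G.norm_Tpol_sub_le hLA.1) hJ m W
  have hMW : ‖M ((G.Tpol μ ν)^[m] W - J)‖ ≤
      δFV * (G.α ^ m * ((1 + G.α) * (G.α ^ (H - 1) * ‖V - Jstar‖) / (1 - G.α))) :=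
    (M.le_of_opNorm_le hM _).trans <| mul_le_mul_of_nonneg_left
      (hiter.trans (mul_le_mul_of_nonneg_left hWJ hαm)) hδ
  have hsplit : M ((G.Tpol μ ν)^[m] W) - Jstar =
      M ((G.Tpol μ ν)^[m] W - J) + (M J - J) + (J - W) + (W - Jstar) := by
    rw [map_sub]
    abel
  have hnorm : ‖M ((G.Tpol μ ν)^[m] W) - Jstar‖ ≤
      ‖M ((G.Tpol μ ν)^[m] W - J)‖ + ‖M J - J‖ + ‖W - J‖ + ‖W - Jstar‖ := by
    rw [hsplit, norm_sub_rev W J]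
    exact norm_add₄_le
  calc _ ≤ _ := hnorm
    _ ≤ δFV * (G.α ^ m * ((1 + G.α) * (G.α ^ (H - 1) * ‖V - Jstar‖) / (1 - G.α))) + δapp +
        (1 + G.α) * (G.α ^ (H - 1) * ‖V - Jstar‖) / (1 - G.α) +
        G.α ^ (H - 1) * ‖V - Jstar‖ := by gcongr
    _ = _ := by ring

end MarkovGame

/-- Theorem 3, noiseless form: For linear maps `M_k` with
`‖M_k‖_∞ ≤ δ'_FV`, step sizes `γ_k ∈ (0,1]` with `Σ γ_k = ∞`, iterates
`V_{k+1} = (1−γ_k)V_k + γ_k M_k(T_{μ_{k+1},ν_{k+1}}^m(T^{H−1}V_k))` with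
`H`-step lookahead policies, approximation error `δ'_app`, and
`δ'_FV α^{m+H−1}(1+α)/(1−α) + 2α^{H−1}/(1−α) < 1`, we have
`limsup_k ‖V_k − J*‖_∞ ≤ δ'_app / (1 − (α^{H−1} + (1+α)(1 + α^m δ'_FV) α^{H−1}/(1−α)))`. -/
theorem stmt_18 {S A B : Type*} [Fintype S] [Fintype A] [Fintype B]
    (G : MarkovGame S A B) (m H : ℕ) (hm : 1 ≤ m) (hH : 1 ≤ H)
    (M : ℕ → (S → ℝ) →L[ℝ] (S → ℝ)) (δFV : ℝ) (hM : ∀ k, ‖M k‖ ≤ δFV)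
    (γ : ℕ → ℝ) (hγ : ∀ k, γ k ∈ Set.Ioc (0 : ℝ) 1)
    (hγsum : Tendsto (fun n => ∑ k ∈ Finset.range n, γ k) atTop atTop)
    (Vseq : ℕ → S → ℝ) (μ : ℕ → S → A → ℝ) (ν : ℕ → S → B → ℝ)
    (hLA : ∀ k, G.IsLookahead H (μ k) (ν k) (Vseq k))
    (hiter : ∀ k, Vseq (k + 1) = (1 - γ k) • Vseq k +
      γ k • (M k) ((G.Tpol (μ k) (ν k))^[m] (G.T^[H - 1] (Vseq k))))
    (Jpol : ℕ → S → ℝ) (hJpol : ∀ k, G.Tpol (μ k) (ν k) (Jpol k) = Jpol k)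
    (δapp : ℝ) (hδapp : 0 ≤ δapp)
    (happ : ∀ k, ‖(M k) (Jpol k) - Jpol k‖ ≤ δapp)
    (hcond : δFV * G.α ^ (m + H - 1) * (1 + G.α) / (1 - G.α) +
      2 * G.α ^ (H - 1) / (1 - G.α) < 1)
    (Jstar : S → ℝ) (hJ : G.T Jstar = Jstar) :
    limsup (fun k => ‖Vseq k - Jstar‖) atTop ≤
      δapp / (1 - (G.α ^ (H - 1) +
        (1 + G.α) * (1 + G.α ^ m * δFV) * G.α ^ (H - 1) / (1 - G.α))) := by
  have hα₀ := G.α_pos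
  have hα : 0 < 1 - G.α := sub_pos.2 G.α_lt_one
  have hδ : 0 ≤ δFV := (norm_nonneg (M 0)).trans (hM 0)
  set β := G.α ^ (H - 1) +
    (1 + G.α) * (1 + G.α ^ m * δFV) * G.α ^ (H - 1) / (1 - G.α) with hβ
  have hβ₀ : 0 ≤ β := by positivity
  have hβ₁ : β < 1 := by
    convert hcond using 1
    rw [hβ, Nat.add_sub_assoc hH, pow_add]
    field_simp
    ring
  refine limsup_le_of_averaged_contraction (fun k => norm_nonneg _) (sub_pos.2 hβ₁)
    (fun k => mul_le_one₀ (hγ k).2 (sub_nonneg.2 hβ₁.le) (by linarith)) hγsum fun k => ?_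
  have hγ₀ := (hγ k).1.le
  have hγ₁ : 0 ≤ 1 - γ k := sub_nonneg.2 (hγ k).2
  have hstep := G.norm_update_sub_le m hH (hM k) (hLA k) (hJpol k) (happ k) hJ
  rw [← hβ] at hstep
  set Y := M k ((G.Tpol (μ k) (ν k))^[m] (G.T^[H - 1] (Vseq k))) with hY
  have hsplit : Vseq (k + 1) - Jstar =
      (1 - γ k) • (Vseq k - Jstar) + γ k • (Y - Jstar) := by
    rw [hiter k, ← hY]
    module
  calc ‖Vseq (k + 1) - Jstar‖
      ≤ (1 - γ k) * ‖Vseq k - Jstar‖ + γ k * ‖Y - Jstar‖ := by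
        rw [hsplit]
        refine (norm_add_le _ _).trans_eq ?_
        rw [norm_smul_of_nonneg hγ₁, norm_smul_of_nonneg hγ₀]
    _ ≤ (1 - γ k) * ‖Vseq k - Jstar‖ + γ k * (β * ‖Vseq k - Jstar‖ + δapp) := by gcongr
    _ = (1 - γ k * (1 - β)) * ‖Vseq k - Jstar‖ + γ k * δapp := by ring
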